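/- arXiv:2307.07010 — 4 statements merged into one kernel-verified Lean document; each statement's English description precedes it below -/
import Mathlib

section
/- Let S be a Polish space and (Qₙ) a sequence of Borel probability measures on S × ℝ converging weakly to a Borel probability measure Q. Assume: (i) Qₙ({(x,m) : m ≥ 0}) = 1 for all n and Q({(x,m) : m ≥ 0}) = 1; (ii) ∫ m dQₙ(x,m) = 1 for all n and ∫ m dQ(x,m) = 1; (iii) lim_{N→∞} sup_n ∫_{\{m > N\}} m dQₙ(x,m) = 0. Then the probability measures Q̃ₙ with density m with respect to Qₙ (i.e., dQ̃ₙ(x,m) = m dQₙ(x,m)) converge weakly to the probability measure Q̃ with dQ̃(x,m) = m dQ(x,m). -/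
open Filter Topology MeasureTheory

open scoped BoundedContinuousFunction

section WeightedConvergence

variable {X : Type*} [TopologicalSpace X]

/-- The truncation `min w N` of a nonnegative continuous function, as a bounded continuous
function. -/
noncomputable def truncatedWeight (w : X → ℝ) (hw : Continuous w) (hw0 : ∀ x, 0 ≤ w x) (N : ℕ) :
    X →ᵇ ℝ :=
  BoundedContinuousFunction.ofNormedAddCommGroup (fun x => min (w x) N)
    (hw.min continuous_const) N fun x => by
      rw [Real.norm_of_nonneg (le_min (hw0 x) N.cast_nonneg)]
      exact min_le_right _ _

lemma truncatedWeight_apply (w : X → ℝ) (hw : Continuous w) (hw0 : ∀ x, 0 ≤ w x) (N : ℕ) (x : X) :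
    truncatedWeight w hw hw0 N x = min (w x) N := rfl

variable [MeasurableSpace X] [OpensMeasurableSpace X]

lemma tendsto_integral_truncatedWeight (w : X → ℝ) (hw : Continuous w) (hw0 : ∀ x, 0 ≤ w x)
    (μ : Measure X) (hint : Integrable w μ) :
    Tendsto (fun N => ∫ x, truncatedWeight w hw hw0 N x ∂μ) atTop (𝓝 (∫ x, w x ∂μ)) := by
  refine tendsto_integral_of_dominated_convergence w
    (fun N => (hw.min continuous_const).measurable.aestronglyMeasurable) hint
    (fun N => .of_forall fun x => ?_) (.of_forall fun x => ?_)
  · rw [truncatedWeight_apply, Real.norm_of_nonneg (le_min (hw0 x) N.cast_nonneg)]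
    exact min_le_left _ _
  · refine tendsto_const_nhds.congr' ?_
    filter_upwards [eventually_ge_atTop ⌈w x⌉₊] with N hN
    rw [truncatedWeight_apply, min_eq_left (Nat.ceil_le.mp hN)]

lemma abs_integral_weight_sub_truncatedWeight_le (w : X → ℝ) (hw : Continuous w)
    (hw0 : ∀ x, 0 ≤ w x) (μ : Measure X) [IsFiniteMeasure μ] (hint : Integrable w μ)
    (f : X →ᵇ ℝ) (N : ℕ) :
    |∫ x, w x * f x ∂μ - ∫ x, (truncatedWeight w hw hw0 N * f) x ∂μ| ≤
      (∫ x, w x ∂μ - ∫ x, truncatedWeight w hw hw0 N x ∂μ) * ‖f‖ := by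
  have hwf : Integrable (fun x => w x * f x) μ :=
    hint.mul_bdd (c := ‖f‖) f.continuous.measurable.aestronglyMeasurable
      (.of_forall f.norm_coe_le_norm)
  have ht := (truncatedWeight w hw hw0 N).integrable μ
  rw [← integral_sub hwf ((truncatedWeight w hw hw0 N * f).integrable μ),
    ← integral_sub hint ht, ← integral_mul_const, ← Real.norm_eq_abs]
  refine norm_integral_le_of_norm_le ((hint.sub ht).mul_const _) (.of_forall fun x => ?_)
  have hx : 0 ≤ w x - truncatedWeight w hw hw0 N x := sub_nonneg.mpr (min_le_left _ _)
  rw [BoundedContinuousFunction.mul_apply, ← sub_mul, norm_mul, Real.norm_of_nonneg hx]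
  exact mul_le_mul_of_nonneg_left (f.norm_coe_le_norm x) hx

/-- If integrals of bounded continuous functions converge and the integrals of a nonnegative
continuous weight `w` converge, then so do the integrals of bounded continuous functions weighted
by `w`. -/
theorem tendsto_integral_weight_mul (w : X → ℝ) (hw : Continuous w) (hw0 : ∀ x, 0 ≤ w x)
    {ι : Type*} {l : Filter ι} {μ : ι → Measure X} [∀ i, IsFiniteMeasure (μ i)]
    {ν : Measure X} [IsFiniteMeasure ν]
    (hconv : ∀ f : X →ᵇ ℝ, Tendsto (fun i => ∫ x, f x ∂μ i) l (𝓝 (∫ x, f x ∂ν)))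
    (hμ : ∀ i, Integrable w (μ i)) (hν : Integrable w ν)
    (hmass : Tendsto (fun i => ∫ x, w x ∂μ i) l (𝓝 (∫ x, w x ∂ν))) (f : X →ᵇ ℝ) :
    Tendsto (fun i => ∫ x, w x * f x ∂μ i) l (𝓝 (∫ x, w x * f x ∂ν)) := by
  let t := truncatedWeight w hw hw0
  let gap (N : ℕ) (ρ : Measure X) : ℝ := (∫ x, w x ∂ρ - ∫ x, t N x ∂ρ) * ‖f‖
  have hgap : Tendsto (fun N => gap N ν + 0 + gap N ν) atTop (𝓝 0) := by
    have h := ((tendsto_integral_truncatedWeight w hw hw0 ν hν).const_sub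
      (∫ x, w x ∂ν)).mul_const ‖f‖
    simpa using (h.add_const 0).add h
  rw [Metric.tendsto_nhds]
  intro ε hε
  obtain ⟨N, hN⟩ := (hgap.eventually_lt_const hε).exists
  have hbound : Tendsto (fun i => gap N (μ i) +
      |∫ x, (t N * f) x ∂μ i - ∫ x, (t N * f) x ∂ν| + gap N ν) l
      (𝓝 (gap N ν + 0 + gap N ν)) := by
    have h := ((hconv (t N * f)).sub_const (∫ x, (t N * f) x ∂ν)).abs
    rw [sub_self, abs_zero] at h
    exact (((hmass.sub (hconv (t N))).mul_const ‖f‖).add h).add_const _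
  filter_upwards [hbound.eventually_lt_const hN] with i hi
  have h₁ := abs_integral_weight_sub_truncatedWeight_le w hw hw0 (μ i) (hμ i) f N
  have h₂ := abs_integral_weight_sub_truncatedWeight_le w hw hw0 ν hν f N
  rw [abs_sub_comm] at h₂
  rw [Real.dist_eq]
  refine lt_of_le_of_lt ?_ hi
  calc _ ≤ _ := abs_sub_le _ (∫ x, (t N * f) x ∂ν) _
    _ ≤ _ := add_le_add (abs_sub_le _ (∫ x, (t N * f) x ∂μ i) _) le_rfl
    _ ≤ _ := add_le_add (add_le_add h₁ le_rfl) h₂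

end WeightedConvergence

/-- If Borel probability measures `Qₙ` on `S × ℝ` (`S` Polish) converge weakly to
`Q`, all giving full mass to `{m ≥ 0}` with `∫ m dQₙ = ∫ m dQ = 1`, and the second coordinate is
uniformly integrable in the sense `lim_N sup_n ∫_{m>N} m dQₙ = 0`, then the tilted probability
measures `dQ̃ₙ = m dQₙ` converge weakly to `dQ̃ = m dQ`. -/
theorem stmt5 {S : Type*} [MetricSpace S] [PolishSpace S]
    [MeasurableSpace S] [BorelSpace S]
    (Q : ℕ → Measure (S × ℝ)) [∀ n, IsProbabilityMeasure (Q n)]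
    (Qlim : Measure (S × ℝ)) [IsProbabilityMeasure Qlim]
    (hconv : ∀ f : BoundedContinuousFunction (S × ℝ) ℝ,
      Tendsto (fun n => ∫ p, f p ∂(Q n)) atTop (𝓝 (∫ p, f p ∂Qlim)))
    (hnonneg : ∀ n, Q n {p : S × ℝ | 0 ≤ p.2} = 1)
    (hnonneg' : Qlim {p : S × ℝ | 0 ≤ p.2} = 1)
    (hmean : ∀ n, ∫⁻ p : S × ℝ, ENNReal.ofReal p.2 ∂(Q n) = 1)
    (hmean' : ∫⁻ p : S × ℝ, ENNReal.ofReal p.2 ∂Qlim = 1)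
    (hui : ∀ ε : ℝ, 0 < ε → ∃ N : ℝ, ∀ n,
      ∫⁻ p in {p : S × ℝ | N < p.2}, ENNReal.ofReal p.2 ∂(Q n) ≤ ENNReal.ofReal ε) :
    ∀ f : BoundedContinuousFunction (S × ℝ) ℝ,
      Tendsto
        (fun n => ∫ p, f p ∂((Q n).withDensity (fun p => ENNReal.ofReal p.2)))
        atTop
        (𝓝 (∫ p, f p ∂(Qlim.withDensity (fun p => ENNReal.ofReal p.2)))) := by
  intro f
  have hmeas : Measurable fun p : S × ℝ => ENNReal.ofReal p.2 :=
    ENNReal.measurable_ofReal.comp measurable_snd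
  have htilt (μ : Measure (S × ℝ)) :
      ∫ p, f p ∂(μ.withDensity fun p => ENNReal.ofReal p.2) = ∫ p, max p.2 0 * f p ∂μ := by
    rw [integral_withDensity_eq_integral_toReal_smul hmeas
      (.of_forall fun _ => ENNReal.ofReal_lt_top)]
    simp only [ENNReal.toReal_ofReal', smul_eq_mul]
  have hint {μ : Measure (S × ℝ)} (h : ∫⁻ p : S × ℝ, ENNReal.ofReal p.2 ∂μ = 1) :
      Integrable (fun p : S × ℝ => max p.2 0) μ := by
    simpa only [ENNReal.toReal_ofReal'] using
      integrable_toReal_of_lintegral_ne_top hmeas.aemeasurable (h.trans_ne ENNReal.one_ne_top)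
  have hmass {μ : Measure (S × ℝ)} (h : ∫⁻ p : S × ℝ, ENNReal.ofReal p.2 ∂μ = 1) :
      ∫ p : S × ℝ, max p.2 0 ∂μ = 1 := by
    simp only [← ENNReal.toReal_ofReal']
    rw [integral_toReal hmeas.aemeasurable (.of_forall fun _ => ENNReal.ofReal_lt_top), h,
      ENNReal.toReal_one]
  simp only [htilt]
  refine tendsto_integral_weight_mul _ (continuous_snd.max continuous_const)
    (fun _ => le_max_right _ _) hconv (fun n => hint (hmean n)) (hint hmean') ?_ f
  simp only [hmass (hmean _), hmass hmean', tendsto_const_nhds]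
end

section
/- Let S be a Polish space, μ a Borel probability measure on S, C₀ > 0, and (Qₙ) a sequence of Borel probability measures on S × ℝ converging weakly to a Borel probability measure Q*. Assume that for every n: (i) the first marginal of Qₙ equals μ; (ii) Qₙ({(x,m) : m > 0}) = 1; (iii) ∫ m dQₙ(x,m) = 1; (iv) ∫ m log m dQₙ(x,m) ≤ C₀; and moreover (v) lim_{N→∞} sup_n ∫_{\{m>N\}} m dQₙ = 0 and lim_{k→∞} sup_n Qₙ({(x,m) : m < 1/k}) = 0. Then Q* satisfies the same structural conditions: the first marginal of Q* equals μ, Q*({(x,m) : m > 0}) = 1, ∫ m dQ*(x,m) = 1, and ∫ m log m dQ*(x,m) ≤ C₀. -/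
open Filter Topology MeasureTheory

/-- The entropy function `φ(m) = m log m` for `m > 0`, `φ(m) = 0` for `m ≤ 0`. -/
noncomputable def entropyFn (m : ℝ) : ℝ := if 0 < m then m * Real.log m else 0

/-- On `(0, ∞)` this is `m log m`, and the truncation at `0` removes the negative part. -/
theorem entropyFn_eq_max_mul_log (m : ℝ) : entropyFn m = max m 0 * Real.log (max m 0) := by
  unfold entropyFn
  split_ifs with h
  · rw [max_eq_left h.le]
  · rw [max_eq_right (not_lt.mp h), zero_mul]

theorem continuous_entropyFn : Continuous entropyFn := by
  simp_rw [funext entropyFn_eq_max_mul_log]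
  exact Real.continuous_mul_log.comp (continuous_id.max continuous_const)

theorem entropyFn_add_one_nonneg (m : ℝ) : 0 ≤ entropyFn m + 1 := by
  unfold entropyFn
  split_ifs with h
  · have h1 := mul_le_mul_of_nonneg_left (Real.one_sub_inv_le_log_of_pos h) h.le
    rw [mul_sub, mul_inv_cancel₀ h.ne'] at h1
    linarith
  · norm_num

/-- Fatou's lemma for weak convergence: a nonnegative continuous function whose integrals are
bounded by `C` along the sequence has integral bounded by `C` in the limit. -/
theorem lintegral_ofReal_le_of_tendsto {X : Type*} [TopologicalSpace X] [MeasurableSpace X]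
    [OpensMeasurableSpace X] [HasOuterApproxClosed X]
    {P : ℕ → ProbabilityMeasure X} {P' : ProbabilityMeasure X} (hP : Tendsto P atTop (𝓝 P'))
    {g : X → ℝ} (hg : Continuous g) (hg0 : 0 ≤ g) {C : ENNReal}
    (hC : ∀ n, ∫⁻ x, ENNReal.ofReal (g x) ∂(P n : Measure X) ≤ C) :
    ∫⁻ x, ENNReal.ofReal (g x) ∂(P' : Measure X) ≤ C :=
  (lintegral_le_liminf_lintegral_of_forall_isOpen_measure_le_liminf_measure hg hg0
    fun _ hG => ProbabilityMeasure.le_liminf_measure_open_of_tendsto hP hG).trans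
      (liminf_le_of_le (by isBoundedDefault) fun _ hb =>
        (hb.exists.elim fun n hn => hn.trans (hC n)))

/-- Continuous cut-off of the second coordinate to the interval `[0, N]`. -/
noncomputable def truncSnd (S : Type*) [TopologicalSpace S] (N : NNReal) :
    BoundedContinuousFunction (S × ℝ) NNReal :=
  BoundedContinuousFunction.mkOfBound
    ⟨fun p => min p.2.toNNReal N, (continuous_real_toNNReal.comp continuous_snd).min
      continuous_const⟩ N (fun p q => by
        rw [NNReal.dist_eq, abs_sub_le_iff]
        have h1 : ((min p.2.toNNReal N : NNReal) : ℝ) ≤ N := NNReal.coe_le_coe.2 (min_le_right _ _)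
        have h2 : ((min q.2.toNNReal N : NNReal) : ℝ) ≤ N := NNReal.coe_le_coe.2 (min_le_right _ _)
        have h3 := (min p.2.toNNReal N).coe_nonneg
        have h4 := (min q.2.toNNReal N).coe_nonneg
        constructor <;> simp only [ContinuousMap.coe_mk] <;> linarith)

theorem truncSnd_apply {S : Type*} [TopologicalSpace S] (N : NNReal) (p : S × ℝ) :
    truncSnd S N p = min p.2.toNNReal N := rfl

theorem ofReal_snd_le_truncSnd_add_indicator {S : Type*} [TopologicalSpace S] (N : ℝ) (p : S × ℝ) :
    ENNReal.ofReal p.2 ≤ truncSnd S N.toNNReal p +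
      {p : S × ℝ | N < p.2}.indicator (fun p => ENNReal.ofReal p.2) p := by
  by_cases h : N < p.2
  · rw [Set.indicator_of_mem (show p ∈ {p : S × ℝ | N < p.2} from h)]
    exact le_add_self
  · rw [truncSnd_apply, min_eq_left (Real.toNNReal_le_toNNReal (not_lt.mp h))]
    exact le_self_add

/-- stability of the structural conditions on relaxed controls under weak limits:
if each `Qₙ` has first marginal `μ`, full mass on `{m > 0}`, `∫ m dQₙ = 1`,
`∫ m log m dQₙ ≤ C₀`, together with the uniform integrability conditions (v), and `Qₙ → Q*`
weakly, then `Q*` has first marginal `μ`, full mass on `{m > 0}`, `∫ m dQ* = 1` and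
`∫ m log m dQ* ≤ C₀`. -/
theorem stmt6 {S : Type*} [MetricSpace S] [PolishSpace S]
    [MeasurableSpace S] [BorelSpace S]
    (μ : Measure S) [IsProbabilityMeasure μ] (C₀ : ℝ) (hC₀ : 0 < C₀)
    (Q : ℕ → Measure (S × ℝ)) [∀ n, IsProbabilityMeasure (Q n)]
    (Qstar : Measure (S × ℝ)) [IsProbabilityMeasure Qstar]
    (hconv : ∀ f : BoundedContinuousFunction (S × ℝ) ℝ,
      Tendsto (fun n => ∫ p, f p ∂(Q n)) atTop (𝓝 (∫ p, f p ∂Qstar)))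
    (hmarg : ∀ n, (Q n).map Prod.fst = μ)
    (hpos : ∀ n, Q n {p : S × ℝ | 0 < p.2} = 1)
    (hmean : ∀ n, ∫⁻ p : S × ℝ, ENNReal.ofReal p.2 ∂(Q n) = 1)
    (hentInt : ∀ n, Integrable (fun p : S × ℝ => entropyFn p.2) (Q n))
    (hent : ∀ n, ∫ p : S × ℝ, entropyFn p.2 ∂(Q n) ≤ C₀)
    (hui : ∀ ε : ℝ, 0 < ε → ∃ N : ℝ, ∀ n,
      ∫⁻ p in {p : S × ℝ | N < p.2}, ENNReal.ofReal p.2 ∂(Q n) ≤ ENNReal.ofReal ε)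
    (hsmall : ∀ ε : ℝ, 0 < ε → ∃ k : ℝ, 0 < k ∧
      ∀ n, Q n {p : S × ℝ | p.2 < 1 / k} ≤ ENNReal.ofReal ε) :
    Qstar.map Prod.fst = μ ∧
    Qstar {p : S × ℝ | 0 < p.2} = 1 ∧
    (∫⁻ p : S × ℝ, ENNReal.ofReal p.2 ∂Qstar) = 1 ∧
    Integrable (fun p : S × ℝ => entropyFn p.2) Qstar ∧
    ∫ p : S × ℝ, entropyFn p.2 ∂Qstar ≤ C₀ := by
  let P : ℕ → ProbabilityMeasure (S × ℝ) := fun n => ⟨Q n, inferInstance⟩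
  let P' : ProbabilityMeasure (S × ℝ) := ⟨Qstar, inferInstance⟩
  have hP : Tendsto P atTop (𝓝 P') :=
    ProbabilityMeasure.tendsto_iff_forall_integral_tendsto.2 hconv
  have hmass : Qstar {p : S × ℝ | 0 < p.2} = 1 := by
    rw [← prob_compl_eq_zero_iff (measurableSet_lt measurable_const measurable_snd)]
    refine le_antisymm (ENNReal.le_of_forall_pos_le_add fun ε hε _ => ?_) zero_le
    obtain ⟨k, hk, hle⟩ := hsmall ε hε
    have hsub : {p : S × ℝ | 0 < p.2}ᶜ ⊆ {p : S × ℝ | p.2 < 1 / k} := fun p hp =>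
      (not_lt.mp (show ¬ 0 < p.2 from hp)).trans_lt (one_div_pos.2 hk)
    rw [zero_add, ← ENNReal.ofReal_coe_nnreal]
    refine (measure_mono hsub).trans ((ProbabilityMeasure.le_liminf_measure_open_of_tendsto hP
      (isOpen_lt continuous_snd continuous_const)).trans ?_)
    exact liminf_le_of_le (by isBoundedDefault) fun _ hb =>
      hb.exists.elim fun n hn => hn.trans (hle n)
  have hent' : ∫⁻ p, ENNReal.ofReal (entropyFn p.2 + 1) ∂Qstar ≤ ENNReal.ofReal (C₀ + 1) := by
    refine lintegral_ofReal_le_of_tendsto hP (P' := P')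
      ((continuous_entropyFn.comp continuous_snd).add continuous_const)
      (fun p => entropyFn_add_one_nonneg p.2) fun n => ?_
    change ∫⁻ p, ENNReal.ofReal (entropyFn p.2 + 1) ∂(Q n) ≤ _
    have hn : Integrable (fun p : S × ℝ => entropyFn p.2 + 1) (Q n) :=
      (hentInt n).add (integrable_const 1)
    rw [← ofReal_integral_eq_lintegral_ofReal hn
      (Eventually.of_forall fun p => entropyFn_add_one_nonneg p.2)]
    apply ENNReal.ofReal_le_ofReal
    rw [integral_add (hentInt n) (integrable_const 1)]
    simpa using hent n
  have hmeas : AEStronglyMeasurable (fun p : S × ℝ => entropyFn p.2 + 1) Qstar :=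
    ((continuous_entropyFn.measurable.comp measurable_snd).add_const 1).aestronglyMeasurable
  have hint1 : Integrable (fun p : S × ℝ => entropyFn p.2 + 1) Qstar :=
    (lintegral_ofReal_ne_top_iff_integrable hmeas
      (Eventually.of_forall fun p => entropyFn_add_one_nonneg p.2)).1
      (hent'.trans_lt ENNReal.ofReal_lt_top).ne
  have hint : Integrable (fun p : S × ℝ => entropyFn p.2) Qstar := by
    simpa [Pi.sub_def] using hint1.sub (integrable_const 1)
  refine ⟨?_, hmass, le_antisymm ?_ ?_, hint, ?_⟩
  · have : IsProbabilityMeasure (Qstar.map Prod.fst) :=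
      Measure.isProbabilityMeasure_map measurable_fst.aemeasurable
    refine ext_of_forall_integral_eq_of_IsFiniteMeasure fun f => ?_
    have hmap (ν : Measure (S × ℝ)) : ∫ x, f x ∂(ν.map Prod.fst) = ∫ p, f p.1 ∂ν :=
      integral_map measurable_fst.aemeasurable f.continuous.measurable.aestronglyMeasurable
    have hlim := hconv (f.compContinuous ⟨Prod.fst, continuous_fst⟩)
    simp only [BoundedContinuousFunction.compContinuous_apply, ContinuousMap.coe_mk] at hlim
    simp_rw [← hmap, hmarg] at hlim
    exact tendsto_nhds_unique hlim tendsto_const_nhds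
  · have h := lintegral_ofReal_le_of_tendsto hP (g := fun p => max p.2 0) (C := 1)
      (continuous_snd.max continuous_const) (fun p => le_max_right _ _) fun n => by
        simpa using! (hmean n).le
    simpa using! h
  · refine ENNReal.le_of_forall_pos_le_add fun ε hε _ => ?_
    obtain ⟨N, hN⟩ := hui ε hε
    have hlim := (ProbabilityMeasure.tendsto_iff_forall_lintegral_tendsto.1 hP)
      (truncSnd S N.toNNReal)
    have hle : 1 ≤ ∫⁻ p, truncSnd S N.toNNReal p ∂Qstar + ε := by
      refine ge_of_tendsto' (hlim.add_const (ε : ENNReal)) fun n => ?_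
      have hset : MeasurableSet {p : S × ℝ | N < p.2} :=
        measurableSet_lt measurable_const measurable_snd
      calc 1 = ∫⁻ p : S × ℝ, ENNReal.ofReal p.2 ∂(Q n) := (hmean n).symm
        _ ≤ ∫⁻ p, (truncSnd S N.toNNReal p +
              {p : S × ℝ | N < p.2}.indicator (fun p => ENNReal.ofReal p.2) p) ∂(Q n) :=
            lintegral_mono fun p => ofReal_snd_le_truncSnd_add_indicator N p
        _ = ∫⁻ p, truncSnd S N.toNNReal p ∂(Q n) +
              ∫⁻ p in {p : S × ℝ | N < p.2}, ENNReal.ofReal p.2 ∂(Q n) := by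
            rw [lintegral_add_right _ (measurable_snd.ennreal_ofReal.indicator hset),
              lintegral_indicator hset]
        _ ≤ ∫⁻ p, truncSnd S N.toNNReal p ∂(Q n) + ε := by
            gcongr
            simpa using hN n
    refine hle.trans ?_
    gcongr with p
    exact ENNReal.coe_le_coe.2 (min_le_left _ _)
  · have h := hent'
    rw [← ofReal_integral_eq_lintegral_ofReal hint1
      (Eventually.of_forall fun p => entropyFn_add_one_nonneg p.2),
      ENNReal.ofReal_le_ofReal_iff (by linarith), integral_add hint (integrable_const 1)] at h
    simpa using h
end

section
/- Let (Ω, 𝔉, P) be a probability space with a filtration (𝔉_t)_{t∈[0,T]}, and let g : [0,T] × Ω → ℝ be a progressively measurable process with E[∫₀^T |g_t| dt] < ∞. Suppose that for all 0 ≤ s ≤ t ≤ T and every A ∈ 𝔉_s one has E[1_A ∫_s^t g_r dr] ≤ 0 (i.e., the process Y_t = ∫₀^t g_r dr is a supermartingale with respect to (𝔉_t)). Then g_t(ω) ≤ 0 for (Lebesgue ⊗ P)-almost every (t,ω) ∈ [0,T] × Ω; equivalently, P-almost surely the path t ↦ ∫₀^t g_r dr is nonincreasing on [0,T]. -/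
open Filter Topology MeasureTheory

/-- Translation in the first variable is continuous for integrals over a fixed set. -/
theorem continuous_setIntegral_translate {f : ℝ → ℝ} (hf : Integrable f) (s : Set ℝ) :
    Continuous fun u : ℝ => ∫ t in s, f (u + t) := by
  have : Fact ((1 : ENNReal) ≠ ⊤) := ⟨ENNReal.one_ne_top⟩
  have hf' : MemLp f 1 volume := memLp_one_iff_integrable.2 hf
  have hc : Continuous fun u : ℝ => DomAddAct.mk u +ᵥ hf'.toLp f :=
    DomAddAct.continuous_mk.vadd continuous_const
  refine ((continuous_setIntegral s).comp hc).congr fun u => ?_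
  refine integral_congr_ae (ae_restrict_of_ae ?_)
  have h : DomAddAct.mk u +ᵥ hf'.toLp f =
      (hf'.comp_measurePreserving (measurePreserving_vadd u volume)).toLp (f <| u +ᵥ ·) :=
    DomAddAct.mk_vadd_toLp u hf'
  dsimp only
  rw [h]
  exact MemLp.coeFn_toLp _

section

variable {Ω : Type*} [MeasurableSpace Ω] {P : Measure Ω} [SFinite P] {G : ℝ × Ω → ℝ}

theorem measurePreserving_translate_fst (P : Measure Ω) [SFinite P] (u : ℝ) :
    MeasurePreserving (fun p : ℝ × Ω => (u + p.1, p.2)) (volume.prod P) (volume.prod P) :=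
  (measurePreserving_add_left volume u).prod (MeasurePreserving.id P)

theorem continuous_setIntegral_prod_translate (hG : Integrable G (volume.prod P))
    {S : Set (ℝ × Ω)} (hS : MeasurableSet S) :
    Continuous fun u : ℝ => ∫ p in S, G (u + p.1, p.2) ∂(volume.prod P) := by
  have hGu : ∀ u : ℝ, Integrable (S.indicator fun p : ℝ × Ω => G (u + p.1, p.2))
      (volume.prod P) := fun u =>
    ((measurePreserving_translate_fst P u).integrable_comp_of_integrable hG).indicator hS
  have key : ∀ u : ℝ, ∫ p in S, G (u + p.1, p.2) ∂(volume.prod P)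
      = ∫ ω, (∫ t in {t | (t, ω) ∈ S}, G (u + t, ω)) ∂P := fun u => by
    rw [← integral_indicator hS, integral_prod_symm _ (hGu u)]
    refine integral_congr_ae (Eventually.of_forall fun ω => ?_)
    exact integral_indicator (μ := volume) (f := fun t => G (u + t, ω))
      (measurable_prodMk_right (y := ω) hS)
  simp_rw [key]
  refine continuous_of_dominated (bound := fun ω => ∫ t, ‖G (t, ω)‖) (fun u => ?_) (fun u => ?_)
    hG.norm.integral_prod_right ?_
  · refine (hGu u).integral_prod_right.aestronglyMeasurable.congr
      (Eventually.of_forall fun ω => ?_)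
    exact integral_indicator (μ := volume) (f := fun t => G (u + t, ω))
      (measurable_prodMk_right (y := ω) hS)
  · filter_upwards [hG.prod_left_ae] with ω hω
    have hω' : Integrable fun t => G (u + t, ω) := hω.comp_add_left u
    calc ‖∫ t in {t | (t, ω) ∈ S}, G (u + t, ω)‖
        ≤ ∫ t in {t | (t, ω) ∈ S}, ‖G (u + t, ω)‖ := norm_integral_le_integral_norm _
      _ ≤ ∫ t, ‖G (u + t, ω)‖ :=
          setIntegral_le_integral hω'.norm (Eventually.of_forall fun _ => norm_nonneg _)
      _ = ∫ t, ‖G (t, ω)‖ := integral_add_left_eq_self (fun t => ‖G (t, ω)‖) u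
  · filter_upwards [hG.prod_left_ae] with ω hω
    exact continuous_setIntegral_translate hω _

theorem integrable_translate_prod (hG : Integrable G (volume.prod P)) (a b : ℝ)
    (S : Set (ℝ × Ω)) :
    Integrable (Function.uncurry fun (u : ℝ) (p : ℝ × Ω) => G (u + p.1, p.2))
      ((volume.restrict (Set.uIoc a b)).prod ((volume.prod P).restrict S)) := by
  have : IsFiniteMeasure (volume.restrict (Set.uIoc a b)) :=
    ⟨by simp [Set.uIoc]⟩
  have hmp : MeasurePreserving (fun q : ℝ × ℝ × Ω => (q.1, (q.1 + q.2.1, q.2.2)))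
      ((volume.restrict (Set.uIoc a b)).prod (volume.prod P))
      ((volume.restrict (Set.uIoc a b)).prod (volume.prod P)) :=
    (MeasurePreserving.id _).skew_product (g := fun (u : ℝ) (p : ℝ × Ω) => (u + p.1, p.2))
      (by fun_prop) (Eventually.of_forall fun u => (measurePreserving_translate_fst P u).map_eq)
  have h := hmp.integrable_comp_of_integrable (hG.comp_snd (volume.restrict (Set.uIoc a b)))
  exact h.mono_measure (Measure.prod_mono le_rfl Measure.restrict_le_self)

theorem intervalIntegral_setIntegral_translate_swap (hG : Integrable G (volume.prod P))
    (a b : ℝ) {S : Set (ℝ × Ω)} (hS : MeasurableSet S) :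
    ∫ u in a..b, (∫ p in S, G (u + p.1, p.2) ∂(volume.prod P)) =
      ∫ t, ∫ ω in {ω | (t, ω) ∈ S}, (∫ u in a..b, G (u + t, ω)) ∂P := by
  have hint := integrable_translate_prod hG a b S
  have hH : IntegrableOn (fun p : ℝ × Ω => ∫ u in a..b, G (u + p.1, p.2)) S
      (volume.prod P) := by
    simp_rw [intervalIntegral.intervalIntegral_eq_integral_uIoc]
    exact hint.integral_prod_right.smul (if a ≤ b then (1 : ℝ) else -1)
  rw [intervalIntegral_integral_swap hint, ← integral_indicator hS,
    integral_prod _ (hH.integrable_indicator hS)]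
  refine integral_congr_ae (Eventually.of_forall fun t => ?_)
  exact integral_indicator (μ := P) (f := fun ω => ∫ u in a..b, G (u + t, ω))
    (measurable_prodMk_left (x := t) hS)

end

theorem nonpos_of_intervalIntegral_nonpos {ψ : ℝ → ℝ} (hψ : Continuous ψ) {δ : ℝ} (hδ : 0 < δ)
    (h : ∀ x, 0 < x → x ≤ δ → ∫ u in (0 : ℝ)..x, ψ u ≤ 0) : ψ 0 ≤ 0 := by
  by_contra! h0
  obtain ⟨ε, hε, hpos⟩ := Metric.eventually_nhds_iff.1 (hψ.tendsto 0 (lt_mem_nhds h0))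
  have hx : 0 < min ε δ := lt_min hε hδ
  refine (h _ hx (min_le_right _ _)).not_gt
    (intervalIntegral.intervalIntegral_pos_of_pos_on (hψ.intervalIntegrable _ _) ?_ hx)
  intro u hu
  refine hpos ?_
  rw [Real.dist_eq, sub_zero, abs_of_pos hu.1]
  exact hu.2.trans_le (min_le_left _ _)

/-- If `g` is a progressively measurable process with
`E[∫₀^T |g_t| dt] < ∞` such that `E[1_A ∫_s^t g_r dr] ≤ 0` for all `0 ≤ s ≤ t ≤ T` and
`A ∈ 𝔉_s` (i.e. `Y_t = ∫₀^t g_r dr` is a supermartingale), then `g ≤ 0` for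
(Lebesgue on `[0,T]`) ⊗ `P`-almost every `(t,ω)`. -/
theorem stmt8 {Ω : Type*} {m0 : MeasurableSpace Ω}
    (P : Measure Ω) [IsProbabilityMeasure P]
    (T : ℝ) (hT : 0 < T)
    (ℱ : Filtration ℝ m0)
    (g : ℝ → Ω → ℝ)
    (hprog : ProgMeasurable ℱ g)
    (hint : Integrable (fun p : ℝ × Ω => g p.1 p.2)
      ((volume.restrict (Set.Icc 0 T)).prod P))
    (hsupermart : ∀ s t : ℝ, 0 ≤ s → s ≤ t → t ≤ T →
      ∀ A : Set Ω, MeasurableSet[ℱ s] A →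
        (∫ ω in A, (∫ r in s..t, g r ω) ∂P) ≤ 0) :
    ∀ᵐ p : ℝ × Ω ∂((volume.restrict (Set.Icc 0 T)).prod P), g p.1 p.2 ≤ 0 := by
  have hI : MeasurableSet (Set.Icc 0 T ×ˢ (Set.univ : Set Ω)) :=
    measurableSet_Icc.prod MeasurableSet.univ
  have hrestrict : (volume.restrict (Set.Icc 0 T)).prod P =
      (volume.prod P).restrict (Set.Icc 0 T ×ˢ (Set.univ : Set Ω)) :=
    Measure.restrict_prod_eq_prod_univ _
  let G : ℝ × Ω → ℝ :=
    (Set.Icc 0 T ×ˢ (Set.univ : Set Ω)).indicator fun p => g p.1 p.2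
  have hG : Integrable G (volume.prod P) := by
    rw [hrestrict] at hint
    exact IntegrableOn.integrable_indicator hint hI
  have hGg : ∀ t ∈ Set.Icc 0 T, ∀ ω, G (t, ω) = g t ω := fun t ht ω =>
    Set.indicator_of_mem (by simpa using ht) _
  have hadapted : ∀ t, Measurable[ℱ t] (g t) := fun t => (IsStronglyProgressive.stronglyAdapted hprog t).measurable
  -- the set where `g` is positive, up to a time `a < T`
  let S : ℝ → Set (ℝ × Ω) := fun a => {p | p.1 ∈ Set.Icc 0 a ∧ 0 < g p.1 p.2}
  have hS : ∀ a ≤ T, MeasurableSet (S a) := fun a ha => by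
    have hmeas : Measurable fun p : Set.Iic T × Ω => g p.1 p.2 :=
      (hprog T).measurable.mono (sup_le_sup le_rfl (MeasurableSpace.comap_mono (ℱ.le T))) le_rfl
    let e : Set.Iic T × Ω → ℝ × Ω := fun p => (p.1, p.2)
    have he : MeasurableEmbedding e :=
      (MeasurableEmbedding.subtype_coe measurableSet_Iic).prodMap MeasurableEmbedding.id
    have hpre : MeasurableSet {p : Set.Iic T × Ω | (p.1 : ℝ) ∈ Set.Icc 0 a ∧ 0 < g p.1 p.2} :=
      ((measurable_subtype_coe.comp measurable_fst) measurableSet_Icc).inter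
        (hmeas measurableSet_Ioi)
    convert! he.measurableSet_image.2 hpre using 1
    ext ⟨t, ω⟩
    constructor
    · rintro ⟨ht, hpos⟩
      exact ⟨(⟨t, ht.2.trans ha⟩, ω), ⟨ht, hpos⟩, rfl⟩
    · rintro ⟨⟨s, ω'⟩, h, heq⟩
      obtain ⟨rfl, rfl⟩ := Prod.mk.inj heq
      exact h
  have hnull : ∀ a < T, (volume.prod P) (S a) = 0 := fun a ha => by
    have hle := nonpos_of_intervalIntegral_nonpos
      (continuous_setIntegral_prod_translate hG (hS a ha.le)) (sub_pos.2 ha) fun x hx0 hx => by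
        rw [intervalIntegral_setIntegral_translate_swap hG 0 x (hS a ha.le)]
        refine integral_nonpos fun t => ?_
        by_cases ht : t ∈ Set.Icc 0 a
        · have hinner : ∀ ω, ∫ u in (0 : ℝ)..x, G (u + t, ω) = ∫ r in t..(t + x), g r ω :=
            fun ω => by
              rw [intervalIntegral.integral_comp_add_right (fun r => G (r, ω)), zero_add,
                add_comm x t]
              refine intervalIntegral.integral_congr fun r hr => hGg r ?_ ω
              rw [Set.uIcc_of_le (by linarith)] at hr
              exact ⟨ht.1.trans hr.1, by linarith [hr.2, ht.2]⟩
          have hset : {ω | (t, ω) ∈ S a} = {ω | 0 < g t ω} := by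
            ext ω
            exact ⟨fun h => h.2, fun h => ⟨ht, h⟩⟩
          simp_rw [hinner, hset]
          exact hsupermart t (t + x) ht.1 (by linarith) (by linarith [ht.2]) _
            (hadapted t measurableSet_Ioi)
        · have hset : {ω | (t, ω) ∈ S a} = ∅ := by
            ext ω
            exact ⟨fun h => ht h.1, fun h => h.elim⟩
          simp [hset]
    simp only [zero_add, Prod.mk.eta] at hle
    have hpos : ∀ p ∈ S a, 0 < G p := fun p hp => by
      have := hGg p.1 ⟨hp.1.1, hp.1.2.trans ha.le⟩ p.2
      rw [Prod.mk.eta] at this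
      exact this ▸ hp.2
    by_contra hne
    refine hle.not_gt ((setIntegral_pos_iff_support_of_nonneg_ae
      ((ae_restrict_mem (hS a ha.le)).mono fun p hp => (hpos p hp).le) hG.integrableOn).2 ?_)
    have hsub : S a ⊆ Function.support G := fun p hp => (hpos p hp).ne'
    rwa [Set.inter_eq_right.2 hsub, pos_iff_ne_zero]
  obtain ⟨a, -, ha, hatends⟩ := exists_seq_strictMono_tendsto T
  have hT0 : ∀ᵐ p : ℝ × Ω ∂(volume.prod P), p.1 ≠ T :=
    Measure.quasiMeasurePreserving_fst.ae (Measure.ae_ne volume T)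
  rw [hrestrict, ae_restrict_iff' hI]
  have hall : ∀ᵐ p : ℝ × Ω ∂(volume.prod P), ∀ n, p ∉ S (a n) :=
    ae_all_iff.2 fun n => measure_eq_zero_iff_ae_notMem.1 (hnull _ (ha n))
  filter_upwards [hT0, hall] with p hpT hp hpI
  obtain ⟨n, hn⟩ := (hatends.eventually (lt_mem_nhds (hpI.1.2.lt_of_ne hpT))).exists
  by_contra! hpos
  exact hp n ⟨⟨hpI.1.1, hn.le⟩, hpos⟩
end

section
/- Let (Ω, 𝔉, P) be a probability space, 𝒢 ⊆ 𝔉 a sub-σ-algebra, and M an integrable random variable with M > 0 P-a.s. Let U : Ω × (0,∞) → ℝ be 𝒢 ⊗ Borel((0,∞))-measurable and such that for each ω the function m ↦ U(ω, m) is strictly concave on (0,∞). Assume that U(·, M) and U(·, E[M | 𝒢]) are integrable and that E[U(·, M)] ≥ E[U(·, E[M | 𝒢])]. Then M = E[M | 𝒢] P-almost surely. -/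
open Filter Topology MeasureTheory

namespace StrictConvexOn

/-- A strictly convex function lies strictly above its right tangent line away from the base
point. -/
theorem add_rightDeriv_mul_sub_lt {S : Set ℝ} {f : ℝ → ℝ} {x y : ℝ}
    (hf : StrictConvexOn ℝ S f) (hx : x ∈ interior S) (hy : y ∈ S) (hxy : y ≠ x) :
    f x + derivWithin f (Set.Ioi x) x * (y - x) < f y := by
  have hxS := interior_subset hx
  rcases hxy.lt_or_gt with h | h
  · have h1 := (hf.slope_lt_leftDeriv hy hxS h
      (hf.convexOn.differentiableWithinAt_Iio_of_mem_interior hx)).trans_le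
      (hf.convexOn.leftDeriv_le_rightDeriv_of_mem_interior hx)
    rw [slope_def_field, div_lt_iff₀ (by linarith)] at h1
    linarith
  · have h1 := hf.rightDeriv_lt_slope hxS hy h
      (hf.convexOn.differentiableWithinAt_Ioi_of_mem_interior hx)
    rw [slope_def_field, lt_div_iff₀ (by linarith)] at h1
    linarith

end StrictConvexOn

theorem measurable_rightDeriv_comp {Ω : Type*} [MeasurableSpace Ω] {f : Ω → ℝ → ℝ} {X : Ω → ℝ}
    (hf : Measurable (fun p : Ω × ℝ => f p.1 p.2)) (hX : Measurable X)
    (hd : ∀ ω, DifferentiableWithinAt ℝ (f ω) (Set.Ioi (X ω)) (X ω)) :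
    Measurable (fun ω => derivWithin (f ω) (Set.Ioi (X ω)) (X ω)) := by
  have hmeas (Y : Ω → ℝ) (hY : Measurable Y) : Measurable (fun ω => f ω (Y ω)) :=
    hf.comp (measurable_id.prodMk hY)
  refine measurable_of_tendsto_metrizable
    (f := fun (n : ℕ) ω => slope (f ω) (X ω) (X ω + 1 / ((n : ℝ) + 1))) (fun n => ?_)
    (tendsto_pi_nhds.2 fun ω => ?_)
  · simp only [slope_def_field]
    have hXn : Measurable (fun ω => X ω + 1 / ((n : ℝ) + 1)) := hX.add_const _
    exact ((hmeas _ hXn).sub (hmeas _ hX)).div (hXn.sub hX)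
  · refine ((hasDerivWithinAt_iff_tendsto_slope' Set.self_notMem_Ioi).1
      (hd ω).hasDerivWithinAt).comp (tendsto_nhdsWithin_iff.2 ⟨?_, ?_⟩)
    · simpa using (tendsto_one_div_add_atTop_nhds_zero_nat (𝕜 := ℝ)).const_add (X ω)
    · exact Eventually.of_forall fun n => Set.mem_Ioi.2 (lt_add_of_pos_right _ Nat.one_div_pos_of_nat)

namespace MeasureTheory

variable {Ω : Type*} {m m0 : MeasurableSpace Ω} {μ : Measure Ω} [IsFiniteMeasure μ]

theorem condExp_pos (hm : m ≤ m0) {f : Ω → ℝ} (hf : Integrable f μ) (hpos : ∀ᵐ ω ∂μ, 0 < f ω) :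
    ∀ᵐ ω ∂μ, 0 < (μ[f|m]) ω := by
  have hA : MeasurableSet[m] {ω | (μ[f|m]) ω ≤ 0} :=
    (stronglyMeasurable_condExp (m := m) (μ := μ) (f := f)).measurable measurableSet_Iic
  have hle : ∫ ω in {ω | (μ[f|m]) ω ≤ 0}, f ω ∂μ ≤ 0 := by
    rw [← setIntegral_condExp hm hf hA]
    exact setIntegral_nonpos (hm _ hA) fun _ h => h
  have hnn : 0 ≤ᵐ[μ.restrict {ω | (μ[f|m]) ω ≤ 0}] f :=
    ae_restrict_of_ae (hpos.mono fun _ h => h.le)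
  have hzero := (integral_eq_zero_iff_of_nonneg_ae hnn hf.integrableOn).1
    (hle.antisymm (integral_nonneg_of_ae hnn))
  filter_upwards [(ae_restrict_iff' (hm _ hA)).1 hzero, hpos] with ω h1 h2
  by_contra! h
  exact h2.ne' (h1 h)

/-- The deviation of `f` from its conditional expectation is orthogonal to bounded
`m`-measurable functions. -/
theorem integral_mul_sub_condExp_eq_zero (hm : m ≤ m0) {f g : Ω → ℝ} (hf : Integrable f μ)
    (hg : StronglyMeasurable[m] g) (c : ℝ) (hc : ∀ ω, ‖g ω‖ ≤ c) :
    Integrable (fun ω => g ω * (f ω - (μ[f|m]) ω)) μ ∧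
      ∫ ω, g ω * (f ω - (μ[f|m]) ω) ∂μ = 0 := by
  have hg0 := (hg.mono hm).aestronglyMeasurable (μ := μ)
  have h1 : Integrable (fun ω => g ω * f ω) μ := hf.bdd_mul hg0 (ae_of_all _ hc)
  have h2 : Integrable (fun ω => g ω * (μ[f|m]) ω) μ :=
    integrable_condExp.bdd_mul hg0 (ae_of_all _ hc)
  have h3 := condExp_stronglyMeasurable_mul_of_bound hm hg hf c (ae_of_all _ hc)
  simp only [mul_sub]
  refine ⟨h1.sub h2, ?_⟩
  rw [integral_sub h1 h2, sub_eq_zero, ← integral_condExp hm]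
  exact integral_congr_ae h3

/-- If the conditional Jensen inequality for a random strictly convex function is reversed in mean,
then the variable agrees almost surely with its conditional expectation. -/
theorem ae_eq_condExp_of_integral_strictConvexOn_le (hm : m ≤ m0) {S : Set ℝ} {φ : Ω → ℝ → ℝ}
    {f X : Ω → ℝ} (hφ : Measurable[m.prod Real.measurableSpace] (fun p : Ω × ℝ => φ p.1 p.2))
    (hconv : ∀ ω, StrictConvexOn ℝ S (φ ω)) (hf : Integrable f μ) (hfS : ∀ᵐ ω ∂μ, f ω ∈ S)
    (hX : Measurable[m] X) (hXS : ∀ ω, X ω ∈ interior S) (hXf : X =ᵐ[μ] μ[f|m])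
    (hint1 : Integrable (fun ω => φ ω (f ω)) μ) (hint2 : Integrable (fun ω => φ ω (X ω)) μ)
    (hle : ∫ ω, φ ω (f ω) ∂μ ≤ ∫ ω, φ ω (X ω) ∂μ) :
    f =ᵐ[μ] X := by
  set D : Ω → ℝ := fun ω => derivWithin (φ ω) (Set.Ioi (X ω)) (X ω)
  have hD : Measurable[m] D := @measurable_rightDeriv_comp Ω m φ X hφ hX fun ω =>
    (hconv ω).convexOn.differentiableWithinAt_Ioi_of_mem_interior (hXS ω)
  set W : Ω → ℝ := fun ω => φ ω (f ω) - φ ω (X ω)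
  have hW : Integrable W μ := hint1.sub hint2
  have hWle : ∫ ω, W ω ∂μ ≤ 0 := by
    rw [integral_sub hint1 hint2]
    linarith
  set L : Ω → ℝ := fun ω => D ω * (f ω - X ω)
  have hlt : ∀ᵐ ω ∂μ, f ω ≠ X ω → L ω < W ω := by
    filter_upwards [hfS] with ω hω hne
    have := (hconv ω).add_rightDeriv_mul_sub_lt (hXS ω) hω hne
    simp only [L, W, D]
    linarith
  have hnn : ∀ᵐ ω ∂μ, 0 ≤ W ω - L ω := by
    filter_upwards [hlt] with ω hω
    by_cases h : f ω = X ω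
    · simp [L, W, h]
    · exact sub_nonneg.2 (hω h).le
  set A : ℕ → Set Ω := fun n => {ω | ‖D ω‖ ≤ n}
  have hA (n : ℕ) : MeasurableSet[m] (A n) :=
    (measurable_norm.comp hD) measurableSet_Iic
  have hA0 (n : ℕ) : MeasurableSet (A n) := hm _ (hA n)
  have hmono : Monotone A := fun i j hij ω (hω : ‖D ω‖ ≤ i) =>
    hω.trans (Nat.cast_le.2 hij)
  have hunion : ⋃ n, A n = Set.univ :=
    Set.eq_univ_of_forall fun ω => Set.mem_iUnion.2 (exists_nat_ge ‖D ω‖)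
  have hL (n : ℕ) : IntegrableOn L (A n) μ ∧ ∫ ω in A n, L ω ∂μ = 0 := by
    have key := integral_mul_sub_condExp_eq_zero hm hf
      (hD.stronglyMeasurable.indicator (hA n)) n fun ω => by
        by_cases h : ω ∈ A n
        · rw [Set.indicator_of_mem h]
          exact h
        · simp [h]
    have heq : (fun ω => (A n).indicator D ω * (f ω - (μ[f|m]) ω)) =ᵐ[μ] (A n).indicator L := by
      filter_upwards [hXf] with ω hω
      rw [← hω, ← Set.indicator_mul_left (A n) D fun ω => f ω - X ω]
    rw [← integrable_indicator_iff (hA0 n), ← integral_indicator (hA0 n),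
      ← integrable_congr heq, ← integral_congr_ae heq]
    exact key
  have hWL (n : ℕ) : ∫ ω in A n, (W ω - L ω) ∂μ = ∫ ω in A n, W ω ∂μ := by
    rw [integral_sub hW.integrableOn (hL n).1, (hL n).2, sub_zero]
  have hmonoW : Monotone fun n => ∫ ω in A n, W ω ∂μ := fun i j hij => by
    simp only [← hWL]
    exact setIntegral_mono_set (hW.integrableOn.sub (hL j).1) (ae_restrict_of_ae hnn)
      (hmono hij).eventuallyLE
  have hlim : Tendsto (fun n => ∫ ω in A n, W ω ∂μ) atTop (𝓝 (∫ ω, W ω ∂μ)) := by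
    simpa [hunion] using tendsto_setIntegral_of_monotone hA0 hmono (hW.integrableOn (s := ⋃ n, A n))
  have hzero : ∀ᵐ ω ∂μ, ∀ n, ω ∈ A n → W ω - L ω = 0 := ae_all_iff.2 fun n => by
    have hnn' : 0 ≤ᵐ[μ.restrict (A n)] fun ω => W ω - L ω := ae_restrict_of_ae hnn
    refine (ae_restrict_iff' (hA0 n)).1 ((integral_eq_zero_iff_of_nonneg_ae hnn'
      (hW.integrableOn.sub (hL n).1)).1 (le_antisymm ?_ (integral_nonneg_of_ae hnn')))
    rw [hWL]
    exact (hmonoW.ge_of_tendsto hlim n).trans hWle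
  filter_upwards [hzero, hlt] with ω h1 h2
  obtain ⟨n, hn⟩ := exists_nat_ge ‖D ω‖
  by_contra h
  linarith [h1 n hn, h2 h]

end MeasureTheory

/-- If `U(ω, ·)` is strictly concave on `(0,∞)`, jointly `𝒢 ⊗ Borel`-measurable,
`M` is integrable with `M > 0` a.s., `U(·,M)` and `U(·,E[M|𝒢])` are integrable, and
`E[U(·,M)] ≥ E[U(·,E[M|𝒢])]`, then `M = E[M|𝒢]` a.s. -/
theorem stmt11 {Ω : Type*} {m0 : MeasurableSpace Ω}
    (P : Measure Ω) [IsProbabilityMeasure P]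
    (𝒢 : MeasurableSpace Ω) (h𝒢 : 𝒢 ≤ m0)
    (M : Ω → ℝ) (hMint : Integrable M P) (hMpos : ∀ᵐ ω ∂P, 0 < M ω)
    (U : Ω → ℝ → ℝ)
    (hUmeas : Measurable[𝒢.prod Real.measurableSpace] (fun p : Ω × ℝ => U p.1 p.2))
    (hUconc : ∀ ω, StrictConcaveOn ℝ (Set.Ioi (0:ℝ)) (U ω))
    (hint1 : Integrable (fun ω => U ω (M ω)) P)
    (hint2 : Integrable (fun ω => U ω ((P[M|𝒢]) ω)) P)
    (hineq : (∫ ω, U ω ((P[M|𝒢]) ω) ∂P) ≤ ∫ ω, U ω (M ω) ∂P) :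
    ∀ᵐ ω ∂P, M ω = (P[M|𝒢]) ω := by
  have hpos := condExp_pos h𝒢 hMint hMpos
  have hE : Measurable[𝒢] (P[M|𝒢]) := stronglyMeasurable_condExp.measurable
  let X : Ω → ℝ := fun ω => if 0 < (P[M|𝒢]) ω then (P[M|𝒢]) ω else 1
  have hX : Measurable[𝒢] X := Measurable.ite (hE measurableSet_Ioi) hE measurable_const
  have hXpos (ω : Ω) : 0 < X ω := by
    dsimp only [X]
    split_ifs with h
    exacts [h, one_pos]
  have hXE : X =ᵐ[P] P[M|𝒢] := hpos.mono fun ω h => if_pos h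
  have hUX : (fun ω => U ω ((P[M|𝒢]) ω)) =ᵐ[P] fun ω => U ω (X ω) :=
    hXE.mono fun ω h => by simp only [h]
  rw [integral_congr_ae hUX] at hineq
  refine (ae_eq_condExp_of_integral_strictConvexOn_le h𝒢 (φ := fun ω y => -U ω y) hUmeas.neg
    (fun ω => (hUconc ω).neg) hMint hMpos hX (fun ω => ?_) hXE hint1.neg
    (hint2.congr hUX).neg ?_).trans hXE
  · rw [interior_Ioi]
    exact hXpos ω
  · simpa only [integral_neg, neg_le_neg_iff] using hineq
end
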